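/- Let I ⊆ ℝ be a finite closed interval and f : ℝ → ℝ a bounded Borel-measurable function. Then T_I(f) is equimeasurable with f on I: for every u ∈ ℝ, λ{t ∈ I : T_I(f)(t) > u} = λ{t ∈ I : f(t) > u}. In particular, ∫_I T_I(f)(t) dt = ∫_I f(t) dt. -/

import Mathlib

open MeasureTheory Set Filter

/-- The upper level set function `r_{f,I}(u) = λ{t ∈ I : f t > u}`. -/
noncomputable def upperLevel (f : ℝ → ℝ) (I : Set ℝ) (u : ℝ) : ℝ :=
  (volume {t | t ∈ I ∧ u < f t}).toReal

/-- The monotone rearrangement `T_I(f)(t) = inf{u ∈ f(I) : r_{f,I}(u) ≤ t - inf I}`. -/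
noncomputable def monoRearr (f : ℝ → ℝ) (I : Set ℝ) (t : ℝ) : ℝ :=
  sInf {u | u ∈ f '' I ∧ upperLevel f I u ≤ t - sInf I}

lemma volume_superlevel_ne_top (f : ℝ → ℝ) (a b u : ℝ) :
    volume {t | t ∈ Icc a b ∧ u < f t} ≠ ⊤ :=
  measure_ne_top_of_subset (fun _ ht => ht.1) (measure_Icc_lt_top (μ := volume)).ne

lemma measurableSet_superlevel {f : ℝ → ℝ} (hf : Measurable f) (a b u : ℝ) :
    MeasurableSet {t | t ∈ Icc a b ∧ u < f t} :=
  measurableSet_Icc.inter (measurableSet_lt measurable_const hf)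

lemma upperLevel_mono {f : ℝ → ℝ} {a b u v : ℝ}
    (h : ∀ t ∈ Icc a b, u < f t → v < f t) :
    upperLevel f (Icc a b) u ≤ upperLevel f (Icc a b) v :=
  ENNReal.toReal_mono (volume_superlevel_ne_top f a b v)
    (measure_mono fun t ht => ⟨ht.1, h t ht.1 ht.2⟩)

lemma upperLevel_le {f : ℝ → ℝ} {a b : ℝ} (hab : a ≤ b) (u : ℝ) :
    upperLevel f (Icc a b) u ≤ b - a := by
  have h := ENNReal.toReal_mono (measure_Icc_lt_top (μ := volume)).ne
    (measure_mono (μ := volume)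
      (fun t ht => ht.1 : {t | t ∈ Icc a b ∧ u < f t} ⊆ Icc a b))
  rwa [Real.volume_Icc, ENNReal.toReal_ofReal (sub_nonneg.2 hab)] at h

/-- The upper level set function is right lower semicontinuous. -/
lemma exists_gt_lt_upperLevel {f : ℝ → ℝ} {a b s u : ℝ}
    (hs : s < upperLevel f (Icc a b) u) :
    ∃ v, u < v ∧ s < upperLevel f (Icc a b) v := by
  obtain ⟨w, hw, hwu, hlim⟩ := exists_seq_strictAnti_tendsto u
  have hmono : Monotone fun n => {t | t ∈ Icc a b ∧ w n < f t} :=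
    fun m n hmn t ht => ⟨ht.1, (hw.antitone hmn).trans_lt ht.2⟩
  have hunion : ⋃ n, {t | t ∈ Icc a b ∧ w n < f t} = {t | t ∈ Icc a b ∧ u < f t} := by
    ext t
    simp only [mem_iUnion, mem_ofPred_eq, exists_and_left]
    refine and_congr_right fun _ => ⟨fun ⟨n, hn⟩ => (hwu n).trans hn, fun h => ?_⟩
    exact (hlim.eventually (gt_mem_nhds h)).exists
  have htend := tendsto_measure_iUnion_atTop (μ := volume) hmono
  rw [hunion] at htend
  have htend' := (ENNReal.tendsto_toReal (volume_superlevel_ne_top f a b u)).comp htend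
  obtain ⟨n, hn⟩ := (htend'.eventually (lt_mem_nhds hs)).exists
  exact ⟨w n, hwu n, hn⟩

lemma exists_mem_image_upperLevel_le {f : ℝ → ℝ} (hf : Measurable f) {a b s u : ℝ}
    (hne : (f '' Icc a b ∩ Iic u).Nonempty) (hs : upperLevel f (Icc a b) u < s) :
    ∃ v ∈ f '' Icc a b, v ≤ u ∧ upperLevel f (Icc a b) v ≤ s := by
  set S := f '' Icc a b ∩ Iic u with hS
  have hbdd : BddAbove S := ⟨u, fun v hv => hv.2⟩
  by_cases hmem : sSup S ∈ S
  · refine ⟨sSup S, hmem.1, hmem.2, le_trans (upperLevel_mono fun t ht hlt => ?_) hs.le⟩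
    by_contra! hle
    exact hlt.not_ge (le_csSup hbdd ⟨mem_image_of_mem f ht, hle⟩)
  · obtain ⟨w, hw, hlim, hwS⟩ := exists_seq_tendsto_sSup hne hbdd
    have hanti : Antitone fun n => {t | t ∈ Icc a b ∧ w n < f t} :=
      fun m n hmn t ht => ⟨ht.1, (hw hmn).trans_lt ht.2⟩
    have hinter : ⋂ n, {t | t ∈ Icc a b ∧ w n < f t} = {t | t ∈ Icc a b ∧ u < f t} := by
      ext t
      simp only [mem_iInter, mem_ofPred_eq]
      refine ⟨fun h => ⟨(h 0).1, ?_⟩, fun h n => ⟨h.1, (hwS n).2.trans_lt h.2⟩⟩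
      by_contra! hle
      have htS : f t ∈ S := ⟨mem_image_of_mem f (h 0).1, hle⟩
      have heq : f t = sSup S :=
        le_antisymm (le_csSup hbdd htS) (le_of_tendsto' hlim fun n => (h n).2.le)
      exact hmem (heq ▸ htS)
    have htend := tendsto_measure_iInter_atTop (μ := volume)
      (fun n => (measurableSet_superlevel hf a b (w n)).nullMeasurableSet) hanti
      ⟨0, volume_superlevel_ne_top f a b (w 0)⟩
    rw [hinter] at htend
    have htend' := (ENNReal.tendsto_toReal (volume_superlevel_ne_top f a b u)).comp htend
    obtain ⟨n, hn⟩ := (htend'.eventually (gt_mem_nhds hs)).exists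
    exact ⟨w n, (hwS n).1, (hwS n).2, hn.le⟩

lemma bddBelow_image_upperLevel_le {f : ℝ → ℝ} (hbd : ∃ M, ∀ t, |f t| ≤ M) (I : Set ℝ) (s : ℝ) :
    BddBelow {u | u ∈ f '' I ∧ upperLevel f I u ≤ s} := by
  obtain ⟨M, hM⟩ := hbd
  refine ⟨-M, ?_⟩
  rintro _ ⟨⟨t, -, rfl⟩, -⟩
  exact (abs_le.1 (hM t)).1

lemma nonempty_image_upperLevel_le {f : ℝ → ℝ} (hf : Measurable f) (hbd : ∃ M, ∀ t, |f t| ≤ M)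
    {a b s : ℝ} (hab : a ≤ b) (hs : 0 < s) :
    {u | u ∈ f '' Icc a b ∧ upperLevel f (Icc a b) u ≤ s}.Nonempty := by
  obtain ⟨M, hM⟩ := hbd
  have hle : ∀ t, f t ≤ M := fun t => (abs_le.1 (hM t)).2
  have hzero : upperLevel f (Icc a b) M = 0 := by
    simp [upperLevel, (hle _).not_gt]
  obtain ⟨v, hv, -, hvs⟩ := exists_mem_image_upperLevel_le hf (u := M) (s := s)
    ⟨f a, mem_image_of_mem f (left_mem_Icc.2 hab), hle a⟩ (hzero ▸ hs)
  exact ⟨v, hv, hvs⟩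

lemma lt_monoRearr {f : ℝ → ℝ} (hf : Measurable f) (hbd : ∃ M, ∀ t, |f t| ≤ M)
    {a b t u : ℝ} (hab : a ≤ b) (ht : a < t) (hu : t - a < upperLevel f (Icc a b) u) :
    u < monoRearr f (Icc a b) t := by
  obtain ⟨v, huv, hv⟩ := exists_gt_lt_upperLevel hu
  rw [monoRearr, csInf_Icc hab]
  refine huv.trans_le (le_csInf (nonempty_image_upperLevel_le hf hbd hab (sub_pos.2 ht)) ?_)
  rintro w ⟨-, hw⟩
  by_contra! hwv
  exact (hw.trans_lt hv).not_ge (upperLevel_mono fun _ _ h => hwv.trans h)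

lemma le_upperLevel_of_lt_monoRearr {f : ℝ → ℝ} (hf : Measurable f)
    (hbd : ∃ M, ∀ t, |f t| ≤ M) {a b t u : ℝ} (hab : a ≤ b) (ht : t ≤ b)
    (hu : u < monoRearr f (Icc a b) t) : t - a ≤ upperLevel f (Icc a b) u := by
  by_contra! hlt
  by_cases hne : (f '' Icc a b ∩ Iic u).Nonempty
  · obtain ⟨v, hv, hvu, hvs⟩ := exists_mem_image_upperLevel_le hf hne hlt
    rw [monoRearr, csInf_Icc hab] at hu
    exact (hu.trans_le (csInf_le (bddBelow_image_upperLevel_le hbd _ _) ⟨hv, hvs⟩)).not_ge hvu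
  · have hall : {x | x ∈ Icc a b ∧ u < f x} = Icc a b := by
      refine Subset.antisymm (fun x hx => hx.1) fun x hx => ⟨hx, ?_⟩
      by_contra! hle
      exact hne ⟨f x, mem_image_of_mem f hx, hle⟩
    rw [upperLevel, hall, Real.volume_Icc, ENNReal.toReal_ofReal (sub_nonneg.2 hab)] at hlt
    linarith

lemma volume_lt_monoRearr {f : ℝ → ℝ} (hf : Measurable f) (hbd : ∃ M, ∀ t, |f t| ≤ M)
    {a b : ℝ} (hab : a ≤ b) (u : ℝ) :
    volume {t | t ∈ Icc a b ∧ u < monoRearr f (Icc a b) t}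
      = volume {t | t ∈ Icc a b ∧ u < f t} := by
  have hr : ENNReal.ofReal (upperLevel f (Icc a b) u) = volume {t | t ∈ Icc a b ∧ u < f t} :=
    ENNReal.ofReal_toReal (volume_superlevel_ne_top f a b u)
  have hub := upperLevel_le (f := f) hab u
  refine le_antisymm ?_ ?_
  · refine (measure_mono (t := Icc a (a + upperLevel f (Icc a b) u)) fun t ht =>
      ⟨ht.1.1, ?_⟩).trans ?_
    · linarith [le_upperLevel_of_lt_monoRearr hf hbd hab ht.1.2 ht.2]
    · rw [Real.volume_Icc, add_sub_cancel_left, hr]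
  · rw [← hr, ← add_sub_cancel_left a (upperLevel f (Icc a b) u), ← Real.volume_Ioo]
    refine measure_mono fun t ht => ⟨⟨ht.1.le, by linarith [ht.2]⟩, ?_⟩
    exact lt_monoRearr hf hbd hab ht.1 (by linarith [ht.2])

lemma antitoneOn_monoRearr {f : ℝ → ℝ} (hf : Measurable f) (hbd : ∃ M, ∀ t, |f t| ≤ M)
    {a b : ℝ} (hab : a ≤ b) : AntitoneOn (monoRearr f (Icc a b)) (Ioc a b) := by
  intro s hs t _ hst
  simp only [monoRearr, csInf_Icc hab]
  exact csInf_le_csInf (bddBelow_image_upperLevel_le hbd _ _)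
    (nonempty_image_upperLevel_le hf hbd hab (sub_pos.2 hs.1))
    fun u hu => ⟨hu.1, hu.2.trans (by linarith)⟩

lemma aemeasurable_monoRearr {f : ℝ → ℝ} (hf : Measurable f) (hbd : ∃ M, ∀ t, |f t| ≤ M)
    {a b : ℝ} (hab : a ≤ b) :
    AEMeasurable (monoRearr f (Icc a b)) (volume.restrict (Icc a b)) := by
  rw [← Measure.restrict_congr_set Ioc_ae_eq_Icc]
  exact aemeasurable_restrict_of_antitoneOn measurableSet_Ioc (antitoneOn_monoRearr hf hbd hab)

lemma map_monoRearr {f : ℝ → ℝ} (hf : Measurable f) (hbd : ∃ M, ∀ t, |f t| ≤ M)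
    {a b : ℝ} (hab : a ≤ b) :
    (volume.restrict (Icc a b)).map (monoRearr f (Icc a b))
      = (volume.restrict (Icc a b)).map f := by
  have hT := aemeasurable_monoRearr hf hbd hab
  refine ext_of_generate_finite _ (borel_eq_generateFrom_Ioi ℝ ▸ BorelSpace.measurable_eq)
    isPiSystem_Ioi ?_ ?_
  · rintro _ ⟨u, rfl⟩
    rw [Measure.map_apply_of_aemeasurable hT measurableSet_Ioi,
      Measure.map_apply hf measurableSet_Ioi,
      Measure.restrict_apply' measurableSet_Icc, Measure.restrict_apply' measurableSet_Icc,
      inter_comm, inter_comm (f ⁻¹' _)]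
    exact volume_lt_monoRearr hf hbd hab u
  · rw [Measure.map_apply_of_aemeasurable hT MeasurableSet.univ,
      Measure.map_apply hf MeasurableSet.univ, preimage_univ, preimage_univ]

/-- The monotone rearrangement `T_I(f)` is equimeasurable with `f` on
`I = [a,b]`: for every `u`, `λ{t ∈ I : T_I(f)(t) > u} = λ{t ∈ I : f(t) > u}`.
In particular its integral over `I` equals that of `f`. -/
theorem monoRearr_equimeasurable
    (a b : ℝ) (hab : a ≤ b) (f : ℝ → ℝ)
    (hf : Measurable f) (hbd : ∃ M, ∀ t, |f t| ≤ M) :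
    (∀ u : ℝ,
      volume {t | t ∈ Icc a b ∧ u < monoRearr f (Icc a b) t}
        = volume {t | t ∈ Icc a b ∧ u < f t}) ∧
    ∫ t in Icc a b, monoRearr f (Icc a b) t = ∫ t in Icc a b, f t := by
  refine ⟨volume_lt_monoRearr hf hbd hab, ?_⟩
  have hT := integral_map (aemeasurable_monoRearr hf hbd hab)
    (f := id) aestronglyMeasurable_id
  rw [map_monoRearr hf hbd hab, integral_map hf.aemeasurable aestronglyMeasurable_id] at hT
  exact hT.symm
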